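/- For every integer n ≥ 1, the number of desarrangements of length n avoiding all three patterns 123, 132, and 213 equals the Fibonacci number f_{n−1}, and the number of desarrangements of length n avoiding all three patterns 231, 312, and 321 also equals f_{n−1}; i.e. d_n({123, 132, 213}) = d_n({231, 312, 321}) = f_{n−1}. -/

import Mathlib

open scoped Classical

/-- Index `i ∈ {1,…,n}` (1-indexed) is an ascent of the permutation `π` of length `n`,
written in one-line notation `π₁π₂⋯πₙ` with `πᵢ = π ⟨i-1, _⟩`: either `i = n`, or
`πᵢ < πᵢ₊₁`. -/
def IsAscent (n : ℕ) (π : Equiv.Perm (Fin n)) (i : ℕ) : Prop :=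
  1 ≤ i ∧ i ≤ n ∧ (i = n ∨ ∃ h : i < n, π ⟨i - 1, by omega⟩ < π ⟨i, h⟩)

/-- A permutation is a desarrangement if it is empty or its first (smallest) ascent is even. -/
def IsDesarrangement (n : ℕ) (π : Equiv.Perm (Fin n)) : Prop :=
  n = 0 ∨ ∃ i, IsAscent n π i ∧ Even i ∧ ∀ j, IsAscent n π j → i ≤ j

/-- `π` contains the pattern `σ` (where `σ` is given in 0-indexed one-line notation):
there are positions `i₁ < ⋯ < i_k` such that the letters of `π` at these positions are
in the same relative order as the letters of `σ`. -/
def ContainsPattern {k n : ℕ} (σ : Fin k → Fin k) (π : Equiv.Perm (Fin n)) : Prop :=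
  ∃ f : Fin k ↪o Fin n, ∀ a b : Fin k, π (f a) < π (f b) ↔ σ a < σ b

/-- `d_n(P)`: the number of desarrangements of length `n` avoiding every pattern in `P`
(patterns of length 3, in 0-indexed one-line notation). -/
noncomputable def dcount (n : ℕ) (P : Finset (Fin 3 → Fin 3)) : ℕ :=
  (Finset.univ.filter fun π : Equiv.Perm (Fin n) =>
    IsDesarrangement n π ∧ ∀ σ ∈ P, ¬ ContainsPattern σ π).card

/-- Letters at distance at least two occur in increasing order. -/
def FarIncreasing {n : ℕ} (π : Equiv.Perm (Fin n)) : Prop :=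
  ∀ i j : Fin n, (i : ℕ) + 2 ≤ j → π i < π j

/-- The direct sum of the permutation `1` and `e`. -/
def oneSum {n : ℕ} (e : Equiv.Perm (Fin n)) : Equiv.Perm (Fin (n + 1)) :=
  Equiv.Perm.decomposeFin.symm (0, e)

/-- The direct sum of the permutation `21` and `e`. -/
def swapSum {n : ℕ} (e : Equiv.Perm (Fin n)) : Equiv.Perm (Fin (n + 2)) :=
  Equiv.Perm.decomposeFin.symm (1, oneSum e)

@[simp] lemma oneSum_zero {n : ℕ} (e : Equiv.Perm (Fin n)) : oneSum e 0 = 0 := by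
  simp [oneSum]

@[simp] lemma oneSum_succ {n : ℕ} (e : Equiv.Perm (Fin n)) (i : Fin n) :
    oneSum e i.succ = (e i).succ := by
  simp [oneSum]

@[simp] lemma swapSum_zero {n : ℕ} (e : Equiv.Perm (Fin n)) : swapSum e 0 = 1 := by
  simp [swapSum]

@[simp] lemma swapSum_one {n : ℕ} (e : Equiv.Perm (Fin n)) : swapSum e 1 = 0 := by
  simp [swapSum]

@[simp] lemma swapSum_succ_succ {n : ℕ} (e : Equiv.Perm (Fin n)) (i : Fin n) :
    swapSum e i.succ.succ = (e i).succ.succ := by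
  rw [swapSum, Equiv.Perm.decomposeFin_symm_apply_succ, oneSum_succ,
    Equiv.swap_apply_of_ne_of_ne] <;> simp [Fin.ext_iff]

lemma oneSum_injective {n : ℕ} : Function.Injective (oneSum (n := n)) := fun a b h => by
  simpa only [oneSum, EmbeddingLike.apply_eq_iff_eq, Prod.mk.injEq, true_and] using h

lemma swapSum_injective {n : ℕ} : Function.Injective (swapSum (n := n)) := fun a b h => by
  simpa [swapSum, oneSum_injective.eq_iff] using h

lemma exists_oneSum_eq {n : ℕ} {π : Equiv.Perm (Fin (n + 1))} (h : π 0 = 0) :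
    ∃ e, oneSum e = π := by
  obtain ⟨⟨p, e⟩, rfl⟩ := Equiv.Perm.decomposeFin.symm.surjective π
  rw [Equiv.Perm.decomposeFin_symm_apply_zero] at h
  exact ⟨e, by rw [oneSum, h]⟩

lemma exists_swapSum_eq {n : ℕ} {π : Equiv.Perm (Fin (n + 2))} (h : π 0 = 1) (h' : π 1 = 0) :
    ∃ e, swapSum e = π := by
  obtain ⟨⟨p, e⟩, rfl⟩ := Equiv.Perm.decomposeFin.symm.surjective π
  rw [Equiv.Perm.decomposeFin_symm_apply_zero] at h
  subst h
  rw [← Fin.succ_zero_eq_one, Equiv.Perm.decomposeFin_symm_apply_succ,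
    Equiv.swap_apply_eq_iff, Equiv.swap_apply_left,
    Fin.succ_inj] at h'
  obtain ⟨e, rfl⟩ := exists_oneSum_eq h'
  exact ⟨e, rfl⟩

lemma farIncreasing_oneSum {n : ℕ} {e : Equiv.Perm (Fin n)} :
    FarIncreasing (oneSum e) ↔ FarIncreasing e := by
  constructor
  · intro h i j hij
    simpa using h i.succ j.succ (by simp; omega)
  · intro h i j hij
    cases j using Fin.cases with
    | zero => simp at hij
    | succ j =>
      cases i using Fin.cases with
      | zero => simp
      | succ i => simpa using h i j (by simp only [Fin.val_succ] at hij; omega)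

lemma farIncreasing_swapSum {n : ℕ} {e : Equiv.Perm (Fin n)} :
    FarIncreasing (swapSum e) ↔ FarIncreasing e := by
  constructor
  · intro h i j hij
    simpa using h i.succ.succ j.succ.succ (by simp; omega)
  · intro h i j hij
    cases j using Fin.cases with
    | zero => simp at hij
    | succ j =>
      cases j using Fin.cases with
      | zero => simp at hij
      | succ j =>
        cases i using Fin.cases with
        | zero => simp [Fin.lt_def]
        | succ i =>
          cases i using Fin.cases with
          | zero => simp
          | succ i =>
            simpa using h i j (by simp only [Fin.val_succ] at hij; omega)

lemma FarIncreasing.exists_sum_eq {n : ℕ} {π : Equiv.Perm (Fin (n + 2))}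
    (h : FarIncreasing π) : (∃ e, oneSum e = π) ∨ ∃ e, swapSum e = π := by
  have position {v : Fin (n + 2)} (hv : v < π 0) : π 1 = v := by
    obtain ⟨k, rfl⟩ := π.surjective v
    have h₀ : k ≠ 0 := by rintro rfl; exact lt_irrefl _ hv
    have h₂ : ¬ 2 ≤ (k : ℕ) := fun hk => (h 0 k (by simpa using hk)).not_gt hv
    have : k = 1 := by
      rw [Ne, Fin.ext_iff] at h₀
      rw [Fin.ext_iff]
      simp only [Fin.val_zero, Fin.val_one] at *
      omega
    rw [this]
  by_cases h₀ : π 0 = 0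
  · exact .inl (exists_oneSum_eq h₀)
  · have h₁ : π 1 = 0 := position (Fin.pos_of_ne_zero h₀)
    refine .inr (exists_swapSum_eq ?_ h₁)
    by_contra hne
    have hlt : 1 < π 0 := by
      rw [Fin.ext_iff] at h₀ hne
      rw [Fin.lt_def]
      simp only [Fin.val_zero, Fin.val_one] at *
      omega
    have := position hlt
    simp [h₁] at this

lemma card_farIncreasing_filter (n : ℕ) (P : Equiv.Perm (Fin (n + 2)) → Prop) :
    (Finset.univ.filter fun π => FarIncreasing π ∧ P π).card =
      (Finset.univ.filter fun e : Equiv.Perm (Fin (n + 1)) =>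
        FarIncreasing e ∧ P (oneSum e)).card +
      (Finset.univ.filter fun e : Equiv.Perm (Fin n) =>
        FarIncreasing e ∧ P (swapSum e)).card := by
  rw [← Finset.card_image_of_injective (Finset.univ.filter fun e => _ ∧ P (oneSum e))
      oneSum_injective,
    ← Finset.card_image_of_injective (Finset.univ.filter fun e => _ ∧ P (swapSum e))
      swapSum_injective,
    ← Finset.card_union_of_disjoint]
  · congr 1
    ext π
    simp only [Finset.mem_filter, Finset.mem_univ, true_and, Finset.mem_union, Finset.mem_image]
    constructor
    · rintro ⟨h, hP⟩
      rcases h.exists_sum_eq with ⟨e, rfl⟩ | ⟨e, rfl⟩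
      · exact .inl ⟨e, ⟨farIncreasing_oneSum.1 h, hP⟩, rfl⟩
      · exact .inr ⟨e, ⟨farIncreasing_swapSum.1 h, hP⟩, rfl⟩
    · rintro (⟨e, ⟨h, hP⟩, rfl⟩ | ⟨e, ⟨h, hP⟩, rfl⟩)
      · exact ⟨farIncreasing_oneSum.2 h, hP⟩
      · exact ⟨farIncreasing_swapSum.2 h, hP⟩
  · rw [Finset.disjoint_left]
    simp only [Finset.mem_filter, Finset.mem_univ, true_and, Finset.mem_image]
    rintro _ ⟨a, -, rfl⟩ ⟨b, -, hb⟩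
    simpa using DFunLike.congr_fun hb 0

lemma farIncreasing_of_le_two {n : ℕ} (hn : n ≤ 2) (π : Equiv.Perm (Fin n)) :
    FarIncreasing π := fun i j hij => by omega

lemma card_farIncreasing : ∀ n : ℕ,
    (Finset.univ.filter fun π : Equiv.Perm (Fin n) => FarIncreasing π).card = Nat.fib (n + 1)
  | 0 => by simp [farIncreasing_of_le_two]
  | 1 => by simp [farIncreasing_of_le_two]
  | n + 2 => by
    have h := card_farIncreasing_filter n fun _ => True
    simp only [and_true] at h
    rw [h, card_farIncreasing (n + 1), card_farIncreasing n, Nat.fib_add_two (n := n + 1),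
      add_comm]

lemma containsPattern_three_iff {n : ℕ} {σ : Fin 3 → Fin 3} {π : Equiv.Perm (Fin n)} :
    ContainsPattern σ π ↔ ∃ x : Fin 3 → Fin n, x 0 < x 1 ∧ x 1 < x 2 ∧
      ∀ a b, π (x a) < π (x b) ↔ σ a < σ b := by
  constructor
  · rintro ⟨f, hf⟩
    exact ⟨f, f.strictMono (by decide), f.strictMono (by decide), hf⟩
  · rintro ⟨x, h₁, h₂, hx⟩
    refine ⟨OrderEmbedding.ofStrictMono x (Fin.strictMono_iff_lt_succ.2 ?_), hx⟩
    intro i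
    fin_cases i
    · exact h₁
    · exact h₂

lemma avoids_iff_farIncreasing {n : ℕ} (π : Equiv.Perm (Fin n)) :
    (∀ σ ∈ ({![1,2,0], ![2,0,1], ![2,1,0]} : Finset (Fin 3 → Fin 3)),
      ¬ ContainsPattern σ π) ↔ FarIncreasing π := by
  simp only [Finset.mem_insert, Finset.mem_singleton, forall_eq_or_imp, forall_eq,
    containsPattern_three_iff]
  constructor
  · rintro ⟨h₁, h₂, h₃⟩ i j hij
    by_contra hlt
    let k : Fin n := ⟨i + 1, by omega⟩
    have hik : i < k := by simp [k, Fin.lt_def]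
    have hkj : k < j := by simp [k, Fin.lt_def]; omega
    have e₁ : π i ≠ π j := π.injective.ne (by omega)
    have e₂ : π i ≠ π k := π.injective.ne (by omega)
    have e₃ : π k ≠ π j := π.injective.ne (by omega)
    rcases lt_or_ge (π i) (π k) with c | c
    · refine h₁ ⟨![i, k, j], hik, hkj, ?_⟩
      simp [Fin.forall_fin_succ]; omega
    rcases lt_or_ge (π k) (π j) with d | d
    · refine h₂ ⟨![i, k, j], hik, hkj, ?_⟩
      simp [Fin.forall_fin_succ]; omega
    · refine h₃ ⟨![i, k, j], hik, hkj, ?_⟩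
      simp [Fin.forall_fin_succ]; omega
  · intro h
    refine ⟨?_, ?_, ?_⟩ <;>
    · rintro ⟨x, h₁, h₂, hx⟩
      exact (h (x 0) (x 2) (by rw [Fin.lt_def] at h₁ h₂; omega)).not_gt
        ((hx 2 0).2 (by decide))

lemma avoids_iff_farIncreasing_trans_rev {n : ℕ} (π : Equiv.Perm (Fin n)) :
    (∀ σ ∈ ({![0,1,2], ![0,2,1], ![1,0,2]} : Finset (Fin 3 → Fin 3)),
      ¬ ContainsPattern σ π) ↔ FarIncreasing (π.trans Fin.revPerm) := by
  simp only [Finset.mem_insert, Finset.mem_singleton, forall_eq_or_imp, forall_eq,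
    containsPattern_three_iff]
  constructor
  · rintro ⟨h₁, h₂, h₃⟩ i j hij
    by_contra hlt
    simp only [Equiv.trans_apply, Fin.revPerm_apply, Fin.rev_lt_rev] at hlt
    let k : Fin n := ⟨i + 1, by omega⟩
    have hik : i < k := by simp [k, Fin.lt_def]
    have hkj : k < j := by simp [k, Fin.lt_def]; omega
    have e₁ : π i ≠ π j := π.injective.ne (by omega)
    have e₂ : π i ≠ π k := π.injective.ne (by omega)
    have e₃ : π k ≠ π j := π.injective.ne (by omega)
    rcases lt_or_ge (π k) (π i) with c | c
    · refine h₃ ⟨![i, k, j], hik, hkj, ?_⟩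
      simp [Fin.forall_fin_succ]; omega
    rcases lt_or_ge (π k) (π j) with d | d
    · refine h₁ ⟨![i, k, j], hik, hkj, ?_⟩
      simp [Fin.forall_fin_succ]; omega
    · refine h₂ ⟨![i, k, j], hik, hkj, ?_⟩
      simp [Fin.forall_fin_succ]; omega
  · intro h
    refine ⟨?_, ?_, ?_⟩ <;>
    · rintro ⟨x, h₁, h₂, hx⟩
      have := h (x 0) (x 2) (by rw [Fin.lt_def] at h₁ h₂; omega)
      simp only [Equiv.trans_apply, Fin.revPerm_apply, Fin.rev_lt_rev] at this
      exact this.not_gt ((hx 0 2).2 (by decide))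

lemma isAscent_one {n : ℕ} {π : Equiv.Perm (Fin (n + 2))} :
    IsAscent (n + 2) π 1 ↔ π 0 < π 1 := by
  simp only [IsAscent]
  constructor
  · rintro ⟨-, -, h | ⟨_, h⟩⟩
    · omega
    · exact h
  · exact fun h => ⟨le_rfl, by omega, .inr ⟨by omega, h⟩⟩

lemma isAscent_length {n : ℕ} (hn : 1 ≤ n) (π : Equiv.Perm (Fin n)) : IsAscent n π n :=
  ⟨hn, le_rfl, .inl rfl⟩

lemma not_isDesarrangement_of_isAscent_one {n : ℕ} {π : Equiv.Perm (Fin n)}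
    (h : IsAscent n π 1) : ¬ IsDesarrangement n π := by
  rintro (rfl | ⟨i, hi, he, hmin⟩)
  · exact absurd h.2.1 (by omega)
  · have := hmin 1 h
    have := hi.1
    obtain rfl : i = 1 := by omega
    exact absurd he (by decide)

lemma isDesarrangement_swapSum {n : ℕ} (e : Equiv.Perm (Fin n)) :
    IsDesarrangement (n + 2) (swapSum e) := by
  refine .inr ⟨2, ⟨by omega, by omega, ?_⟩, even_two, ?_⟩
  · cases n with
    | zero => exact .inl rfl
    | succ n =>
      refine .inr ⟨by omega, ?_⟩
      change swapSum e 1 < swapSum e (0 : Fin (n + 1)).succ.succ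
      rw [swapSum_one, swapSum_succ_succ]
      exact Fin.succ_pos _
  · intro j hj
    by_contra hlt
    have := hj.1
    obtain rfl : j = 1 := by omega
    rw [isAscent_one] at hj
    simp at hj

lemma isDesarrangement_iff_of_isAscent_succ {n : ℕ} {π : Equiv.Perm (Fin (n + 1))}
    {e : Equiv.Perm (Fin n)} (hn : 1 ≤ n) (h₁ : ¬ IsAscent (n + 1) π 1)
    (h : ∀ i, 1 ≤ i → (IsAscent (n + 1) π (i + 1) ↔ IsAscent n e i)) :
    IsDesarrangement (n + 1) π ↔ ¬ IsDesarrangement n e := by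
  have hex : ∃ i, IsAscent n e i := ⟨n, isAscent_length hn e⟩
  obtain ⟨m, hm, hmin⟩ : ∃ m, IsAscent n e m ∧ ∀ j, IsAscent n e j → m ≤ j :=
    ⟨Nat.find hex, Nat.find_spec hex, fun j hj => Nat.find_min' hex hj⟩
  have he : IsDesarrangement n e ↔ Even m := by
    constructor
    · rintro (rfl | ⟨i, hi, hev, hi'⟩)
      · omega
      · rwa [← le_antisymm (hi' m hm) (hmin i hi)]
    · exact fun hev => .inr ⟨m, hm, hev, hmin⟩
  have hm' : IsAscent (n + 1) π (m + 1) := (h m hm.1).2 hm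
  have hmin' : ∀ j, IsAscent (n + 1) π j → m + 1 ≤ j := by
    intro j hj
    obtain ⟨k, rfl⟩ : ∃ k, j = k + 1 := ⟨j - 1, by have := hj.1; omega⟩
    rcases Nat.eq_zero_or_pos k with rfl | hk
    · exact absurd hj h₁
    · exact Nat.succ_le_succ (hmin k ((h k hk).1 hj))
  rw [he, ← Nat.even_add_one]
  constructor
  · rintro (h0 | ⟨i, hi, hev, hi'⟩)
    · omega
    · rwa [← le_antisymm (hi' _ hm') (hmin' i hi)]
  · exact fun hev => .inr ⟨m + 1, hm', hev, hmin'⟩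

lemma isDesarrangement_oneSum_rev {n : ℕ} (e : Equiv.Perm (Fin (n + 1))) :
    IsDesarrangement (n + 2) ((oneSum e).trans Fin.revPerm) ↔
      ¬ IsDesarrangement (n + 1) (e.trans Fin.revPerm) := by
  refine isDesarrangement_iff_of_isAscent_succ (by omega) ?_ ?_
  · rw [isAscent_one, ← Fin.succ_zero_eq_one]
    simp only [Equiv.trans_apply, Fin.revPerm_apply, Fin.rev_lt_rev, oneSum_zero]
    exact Fin.not_lt_zero _
  · intro i hi
    obtain ⟨i, rfl⟩ : ∃ k, i = k + 1 := ⟨i - 1, by omega⟩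
    simp only [IsAscent, Nat.add_sub_cancel, Equiv.trans_apply, Fin.revPerm_apply,
      Fin.rev_lt_rev]
    refine and_congr (by omega) (and_congr (by omega) (or_congr (by omega) ?_))
    have key (h : i + 1 < n + 1) :
        oneSum e ⟨i + 1 + 1, by omega⟩ < oneSum e ⟨i + 1, by omega⟩ ↔
          e ⟨i + 1, h⟩ < e ⟨i, by omega⟩ := by
      rw [← Fin.succ_lt_succ_iff (a := e _), ← oneSum_succ e, ← oneSum_succ e]
      rfl
    exact ⟨fun ⟨h, h'⟩ => ⟨by omega, (key (by omega)).1 h'⟩,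
      fun ⟨h, h'⟩ => ⟨by omega, (key h).2 h'⟩⟩

lemma card_farIncreasing_isDesarrangement_rev : ∀ n : ℕ,
    (Finset.univ.filter fun e : Equiv.Perm (Fin (n + 1)) =>
      FarIncreasing e ∧ IsDesarrangement (n + 1) (e.trans Fin.revPerm)).card = Nat.fib n
  | 0 => by
    simp [not_isDesarrangement_of_isAscent_one (isAscent_length le_rfl _)]
  | n + 1 => by
    have h₂ (e : Equiv.Perm (Fin n)) :
        ¬ IsDesarrangement (n + 2) ((swapSum e).trans Fin.revPerm) :=
      not_isDesarrangement_of_isAscent_one (isAscent_one.2 (by simp [-Fin.rev_zero]))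
    rw [card_farIncreasing_filter n fun e => IsDesarrangement (n + 2) (e.trans Fin.revPerm)]
    simp only [h₂, and_false, Finset.filter_false, Finset.card_empty, add_zero,
      isDesarrangement_oneSum_rev]
    have hsum := Finset.card_filter_add_card_filter_not
      (s := Finset.univ.filter fun e : Equiv.Perm (Fin (n + 1)) => FarIncreasing e)
      (fun e => IsDesarrangement (n + 1) (e.trans Fin.revPerm))
    rw [Finset.filter_filter, Finset.filter_filter, card_farIncreasing,
      card_farIncreasing_isDesarrangement_rev n, Nat.fib_add_two] at hsum
    omega

lemma card_farIncreasing_isDesarrangement : ∀ n : ℕ,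
    (Finset.univ.filter fun e : Equiv.Perm (Fin (n + 1)) =>
      FarIncreasing e ∧ IsDesarrangement (n + 1) e).card = Nat.fib n
  | 0 => by
    simp [not_isDesarrangement_of_isAscent_one (isAscent_length le_rfl _)]
  | n + 1 => by
    have h₁ (e : Equiv.Perm (Fin (n + 1))) : ¬ IsDesarrangement (n + 2) (oneSum e) :=
      not_isDesarrangement_of_isAscent_one
        (isAscent_one.2 (by rw [← Fin.succ_zero_eq_one, oneSum_succ]; simp))
    rw [card_farIncreasing_filter n (IsDesarrangement (n + 2))]
    simp [h₁, isDesarrangement_swapSum, card_farIncreasing]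

/-- For every integer `n ≥ 1`, `d_n({123, 132, 213}) = f_(n−1)` and
`d_n({231, 312, 321}) = f_(n−1)`, where `f` is the Fibonacci sequence
(`f₀ = 0`, `f₁ = 1`). -/
theorem desarrangements_fibonacci (n : ℕ) (hn : 1 ≤ n) :
    dcount n {![0,1,2], ![0,2,1], ![1,0,2]} = Nat.fib (n - 1) ∧
    dcount n {![1,2,0], ![2,0,1], ![2,1,0]} = Nat.fib (n - 1) := by
  obtain ⟨n, rfl⟩ : ∃ k, n = k + 1 := ⟨n - 1, by omega⟩
  have rev_rev (π : Equiv.Perm (Fin (n + 1))) :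
      (π.trans Fin.revPerm).trans Fin.revPerm = π := by ext; simp
  constructor
  · simp only [dcount, avoids_iff_farIncreasing_trans_rev, Nat.add_sub_cancel]
    rw [← card_farIncreasing_isDesarrangement_rev n]
    refine Finset.card_bij' (fun π _ => π.trans Fin.revPerm) (fun π _ => π.trans Fin.revPerm)
      ?_ ?_ (fun π _ => rev_rev π) (fun π _ => rev_rev π)
    · intro π h
      simpa [rev_rev, and_comm] using h
    · intro π h
      simpa [rev_rev, and_comm] using h
  · simp only [dcount, avoids_iff_farIncreasing, Nat.add_sub_cancel]
    rw [← card_farIncreasing_isDesarrangement n]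
    simp only [and_comm]
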